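/- Let G,G' be multi-valued regulatory graphs sharing the same V and ρ, with parametrizations K ∈ K_G and K' ∈ K_{G'}. Denote Min*(Norm(G,K)) and Min*(Norm(G',K')) the fixed points obtained by iterating the minimization Min starting in Norm(G,K) and Norm(G',K') respectively. Then T_G(K) = T_{G'}(K') if and only if Min*(Norm(G,K)) = Min*(Norm(G',K')). -/

import Mathlib

/-!
Formalization of multi-valued regulatory graphs (Thomas networks),
their parametrizations, asynchronous transition systems,
canonization, completion, normalization and minimization.
-/

namespace MVReg

open Classical

/-- A multi-valued regulatory graph over components `V` with maximal
activity levels `ρ`: a finite set of regulations `(u, n, v)` with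
threshold `0 < n ≤ ρ u`. -/
structure RegGraph (V : Type*) (ρ : V → ℕ) where
  E : Finset (V × ℕ × V)
  valid : ∀ e ∈ E, 1 ≤ e.2.1 ∧ e.2.1 ≤ ρ e.1

/-- A (total) parametrization candidate: a value for each component and
each potential regulatory context (a context assigns to each regulator
an interval, represented by its pair of endpoints `[j, k)`). -/
abbrev Param (V : Type*) := V → (V → ℕ × ℕ) → ℕ

variable {V : Type*} [DecidableEq V] [Fintype V] {ρ : V → ℕ}

/-- The extended threshold set `Θ(u,v) = θ(u,v) ∪ {0, ρ u + 1}`. -/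
def Theta (G : RegGraph V ρ) (u v : V) : Set ℕ :=
  {m | (u, m, v) ∈ G.E} ∪ {0, ρ u + 1}

/-- Activity intervals `I_v^u`: pairs `(j,k)` (representing `[j,k)`) of
consecutive members of `Θ(u,v)`. -/
def ActInterval (G : RegGraph V ρ) (u v : V) : Set (ℕ × ℕ) :=
  {p | p.1 ∈ Theta G u v ∧ p.2 ∈ Theta G u v ∧ p.1 < p.2 ∧
    ∀ l ∈ Theta G u v, ¬ (p.1 < l ∧ l < p.2)}

/-- The regulatory contexts `Ω_v` of a component `v`. -/
def Context (G : RegGraph V ρ) (v : V) : Set (V → ℕ × ℕ) :=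
  {ω | ∀ u, ω u ∈ ActInterval G u v}

/-- `K ∈ 𝒦_G` : on every regulatory context of `v` the value lies in `[0, ρ v]`. -/
def IsParam (G : RegGraph V ρ) (K : Param V) : Prop :=
  ∀ v : V, ∀ ω ∈ Context G v, K v ω ≤ ρ v

/-- The state space `S = ∏_v [0, ρ v]`. -/
def States (ρ : V → ℕ) : Set (V → ℕ) := {s | ∀ v, s v ≤ ρ v}

/-- `s ∈ ω` : the state `s` lies in the context `ω`. -/
def memCtx (ω : V → ℕ × ℕ) (s : V → ℕ) : Prop :=
  ∀ u, (ω u).1 ≤ s u ∧ s u < (ω u).2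

/-- The (unique) regulatory context of `v` containing the state `s`. -/
noncomputable def ctxOf (G : RegGraph V ρ) (v : V) (s : V → ℕ) : V → ℕ × ℕ :=
  fun u => (sSup {m | m ∈ Theta G u v ∧ m ≤ s u}, sInf {m | m ∈ Theta G u v ∧ s u < m})

/-- The asynchronous update function `F^K_v`. -/
noncomputable def F (G : RegGraph V ρ) (K : Param V) (v : V) (s : V → ℕ) : ℕ :=
  if s v < K v (ctxOf G v s) then s v + 1
  else if s v = K v (ctxOf G v s) then s v
  else s v - 1

/-- The derivative `δ(F^K_v)(s) = F^K_v(s) − s_v` (as an integer). -/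
noncomputable def delta (G : RegGraph V ρ) (K : Param V) (v : V) (s : V → ℕ) : ℤ :=
  (F G K v s : ℤ) - (s v : ℤ)

/-- The asynchronous transition system `T_G(K)`, as the set of transitions. -/
noncomputable def TS (G : RegGraph V ρ) (K : Param V) : Set ((V → ℕ) × (V → ℕ)) :=
  {p | p.1 ∈ States ρ ∧ p.2 ∈ States ρ ∧ p.1 ≠ p.2 ∧
    ∃ v : V, p.2 = Function.update p.1 v (F G K v p.1)}

/-- The synchronous transition system of `(G, K)`. -/
noncomputable def SyncTS (G : RegGraph V ρ) (K : Param V) : Set ((V → ℕ) × (V → ℕ)) :=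
  {p | p.1 ∈ States ρ ∧ p.2 ∈ States ρ ∧ ∀ v : V, p.2 v = F G K v p.1}

/-- A parametrization is canonical iff `j − 1 ≤ K_v(ω) ≤ k` for every context with
`ω_v = [j,k)`. -/
def Canonical (G : RegGraph V ρ) (K : Param V) : Prop :=
  ∀ v : V, ∀ ω ∈ Context G v, (ω v).1 - 1 ≤ K v ω ∧ K v ω ≤ (ω v).2

/-- The canonization of a parametrization. -/
noncomputable def CanP (K : Param V) : Param V := fun v ω =>
  if K v ω + 1 < (ω v).1 then (ω v).1 - 1
  else if (ω v).2 < K v ω then (ω v).2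
  else K v ω

/-- A regulatory graph is complete iff it contains every possible edge. -/
def Complete (G : RegGraph V ρ) : Prop :=
  ∀ u v : V, ∀ n : ℕ, 1 ≤ n → n ≤ ρ u → (u, n, v) ∈ G.E

/-- The finite set of all possible edges for activity levels `ρ`. -/
def allEdges (ρ : V → ℕ) : Finset (V × ℕ × V) :=
  Finset.filter (fun e => 1 ≤ e.2.1 ∧ e.2.1 ≤ ρ e.1)
    (Finset.univ ×ˢ (Finset.Icc 1 (Finset.univ.sup ρ)) ×ˢ Finset.univ)

/-- `n_−`: the largest element of `Θ(u,v)` strictly below `n`. -/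
noncomputable def nminus (G : RegGraph V ρ) (u v : V) (n : ℕ) : ℕ :=
  sSup {m | m ∈ Theta G u v ∧ m < n}

/-- `n_+`: the smallest element of `Θ(u,v)` strictly above `n`. -/
noncomputable def nplus (G : RegGraph V ρ) (u v : V) (n : ℕ) : ℕ :=
  sInf {m | m ∈ Theta G u v ∧ n < m}

/-- The parametrization accompanying the completion by the edge `e = (u, n, v)`:
the two contexts obtained by splitting a context of `G` at `n` both inherit the
original value. (`n_−, n_+` are taken w.r.t. the graph `G` before insertion.) -/
noncomputable def CompParam (G : RegGraph V ρ) (K : Param V) (e : V × ℕ × V) : Param V :=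
  fun w ω =>
    if w = e.2.2 ∧ (ω e.1 = (nminus G e.1 e.2.2 e.2.1, e.2.1) ∨
                    ω e.1 = (e.2.1, nplus G e.1 e.2.2 e.2.1))
    then K e.2.2 (Function.update ω e.1 (nminus G e.1 e.2.2 e.2.1, nplus G e.1 e.2.2 e.2.1))
    else K w ω

/-- One completion step: add the least missing edge (w.r.t. the fixed total
order) and extend the parametrization conservatively; complete graphs are fixed. -/
noncomputable def Comp [LinearOrder (V × ℕ × V)] (P : RegGraph V ρ × Param V) :
    RegGraph V ρ × Param V :=
  if h : ((allEdges ρ) \ P.1.E).Nonempty then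
    (⟨insert (((allEdges ρ) \ P.1.E).min' h) P.1.E, by
        intro e' he'
        rcases Finset.mem_insert.mp he' with h1 | h1
        · have hmem := Finset.min'_mem ((allEdges ρ) \ P.1.E) h
          have hall : ((allEdges ρ) \ P.1.E).min' h ∈ allEdges ρ :=
            (Finset.mem_sdiff.mp hmem).1
          rw [h1]
          exact (Finset.mem_filter.mp hall).2
        · exact P.1.valid e' h1⟩,
      CompParam P.1 P.2 (((allEdges ρ) \ P.1.E).min' h))
  else P

/-- `P` is a fixed point of `f` reached by iterating `f` from `start`. -/
def IsFixReached {α : Type*} (f : α → α) (start P : α) : Prop :=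
  (∃ n : ℕ, f^[n] start = P) ∧ f P = P

/-- Equality of parametrized regulatory graphs: the graphs coincide and the
parametrizations agree on all regulatory contexts. -/
def PGEq (A B : RegGraph V ρ × Param V) : Prop :=
  A.1 = B.1 ∧ ∀ v : V, ∀ ω ∈ Context A.1 v, A.2 v ω = B.2 v ω

/-- Replacing the value of `K` at component `v` and context `ω` by `j'`. -/
noncomputable def replaceAt (K : Param V) (v : V) (ω : V → ℕ × ℕ) (j' : ℕ) : Param V :=
  fun w ω' => if w = v ∧ ω' = ω then j' else K w ω'

/-- The edge `e = (u,n,v)` is not observable in the parametrization `K`. -/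
def NotObsParam (G : RegGraph V ρ) (K : Param V) (e : V × ℕ × V) : Prop :=
  ∀ ω ∈ Context G e.2.2, ω e.1 = (e.2.1, nplus G e.1 e.2.2 e.2.1) →
    K e.2.2 ω = K e.2.2 (Function.update ω e.1 (nminus G e.1 e.2.2 e.2.1, e.2.1))

/-- The edge `e = (u,n,v)` is not observable in the transition system `T_G(K)`. -/
def NotObsTS (G : RegGraph V ρ) (K : Param V) (e : V × ℕ × V) : Prop :=
  ∀ s ∈ States ρ, nminus G e.1 e.2.2 e.2.1 ≤ s e.1 → s e.1 < nplus G e.1 e.2.2 e.2.1 →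
    ∃ k ≤ ρ e.2.2, ∀ j : ℕ, nminus G e.1 e.2.2 e.2.1 ≤ j → j < nplus G e.1 e.2.2 e.2.1 →
      delta G K e.2.2 (Function.update s e.1 j) =
        Int.sign ((k : ℤ) - ((Function.update s e.1 j) e.2.2 : ℤ))

/-- The monotone target value `(F^K_v)^{mon}(s)`. -/
noncomputable def mon (G : RegGraph V ρ) (K : Param V) (v : V) (s : V → ℕ) : ℕ :=
  if delta G K v s = 0 then s v
  else if delta G K v s = 1 then
    sInf {j | s v < j ∧ delta G K v (Function.update s v j) ≠ 1}
  else
    sSup {j | j < s v ∧ delta G K v (Function.update s v j) ≠ -1}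

/-- Non-observability of `e = (u,n,v)` in `T_G(K)` phrased via monotone target values. -/
def NotObsTSmon (G : RegGraph V ρ) (K : Param V) (e : V × ℕ × V) : Prop :=
  ∀ s ∈ States ρ, nminus G e.1 e.2.2 e.2.1 ≤ s e.1 → s e.1 < nplus G e.1 e.2.2 e.2.1 →
    ∀ j : ℕ, nminus G e.1 e.2.2 e.2.1 ≤ j → j < nplus G e.1 e.2.2 e.2.1 →
      delta G K e.2.2 (Function.update s e.1 j) =
        Int.sign ((mon G K e.2.2 s : ℤ) - ((Function.update s e.1 j) e.2.2 : ℤ))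

/-- In the normalization algorithm: the context below the current one
(the `v`-interval is replaced by its predecessor interval `[n_{i−1}, n_i)`). -/
noncomputable def updLow (G : RegGraph V ρ) (v : V) (ω : V → ℕ × ℕ) : V → ℕ × ℕ :=
  Function.update ω v (sSup {m | m ∈ Theta G v v ∧ m < (ω v).1}, (ω v).1)

/-- In the normalization algorithm: the context above the current one
(the `v`-interval is replaced by its successor interval `[n_{i+1}, n_{i+2})`). -/
noncomputable def updHigh (G : RegGraph V ρ) (v : V) (ω : V → ℕ × ℕ) : V → ℕ × ℕ :=
  Function.update ω v ((ω v).2, sInf {m | m ∈ Theta G v v ∧ (ω v).2 < m})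

/-- The recursive normalization algorithm `Norm(K, v, ω)` of the paper, as an
inductive big-step relation: `NormRel G K v ω r` holds iff the recursion
started at `ω` terminates with result `r`. -/
inductive NormRel (G : RegGraph V ρ) (K : Param V) (v : V) : (V → ℕ × ℕ) → ℕ → Prop
  | inside (ω : V → ℕ × ℕ) (h1 : (ω v).1 ≤ K v ω) (h2 : K v ω < (ω v).2) :
      NormRel G K v ω (K v ω)
  | belowStop (ω : V → ℕ × ℕ) (h : K v ω < (ω v).1)
      (h2 : (ω v).1 - 1 ≤ K v (updLow G v ω)) :
      NormRel G K v ω ((ω v).1 - 1)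
  | belowRec (ω : V → ℕ × ℕ) (r : ℕ) (h : K v ω < (ω v).1)
      (h2 : K v (updLow G v ω) < (ω v).1 - 1)
      (hrec : NormRel G K v (updLow G v ω) r) :
      NormRel G K v ω r
  | aboveStop (ω : V → ℕ × ℕ) (h : (ω v).2 ≤ K v ω)
      (h2 : K v (updHigh G v ω) ≤ (ω v).2) :
      NormRel G K v ω ((ω v).2)
  | aboveRec (ω : V → ℕ × ℕ) (r : ℕ) (h : (ω v).2 ≤ K v ω)
      (h2 : (ω v).2 < K v (updHigh G v ω))
      (hrec : NormRel G K v (updHigh G v ω) r) :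
      NormRel G K v ω r

/-- The normalized parametrization: each context gets the common monotone
target value of its states (represented by the lower corner of the context). -/
noncomputable def NormPm (G : RegGraph V ρ) (K : Param V) : Param V :=
  fun v ω => mon G K v (fun u => (ω u).1)

/-- The edges of `G` that are not observable in `N`. -/
noncomputable def nonObsEdges (G : RegGraph V ρ) (N : Param V) : Finset (V × ℕ × V) :=
  G.E.filter (fun e => NotObsParam G N e)

/-- The parametrization accompanying the removal of the non-observable edge
`e = (u,n,v)`: the two contexts merged into one pass on their common value. -/
noncomputable def MinParam (G : RegGraph V ρ) (N : Param V) (e : V × ℕ × V) : Param V :=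
  fun w ω =>
    if w = e.2.2 ∧ ω e.1 = (nminus G e.1 e.2.2 e.2.1, nplus G e.1 e.2.2 e.2.1)
    then N e.2.2 (Function.update ω e.1 (nminus G e.1 e.2.2 e.2.1, e.2.1))
    else N w ω

/-- One minimization step: remove the least edge (w.r.t. the fixed total order)
that is not observable in `N`; if all edges are observable, do nothing. -/
noncomputable def Minim [LinearOrder (V × ℕ × V)] (P : RegGraph V ρ × Param V) :
    RegGraph V ρ × Param V :=
  if h : (nonObsEdges P.1 P.2).Nonempty then
    (⟨P.1.E.erase ((nonObsEdges P.1 P.2).min' h),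
        fun e' he' => P.1.valid e' (Finset.mem_of_mem_erase he')⟩,
      MinParam P.1 P.2 ((nonObsEdges P.1 P.2).min' h))
  else P


lemma theta_le (G : RegGraph V ρ) {u v : V} {m : ℕ} (h : m ∈ Theta G u v) : m ≤ ρ u + 1 := by
  rcases h with h | h
  · have := (G.valid _ h).2
    simp at this
    omega
  · simp at h
    omega

lemma zero_theta (G : RegGraph V ρ) (u v : V) : 0 ∈ Theta G u v := Or.inr (by simp)

lemma top_theta (G : RegGraph V ρ) (u v : V) : ρ u + 1 ∈ Theta G u v := Or.inr (by simp)

lemma max_spec (A : Set ℕ) (b : ℕ) (h0 : ∃ m, m ∈ A) (hb : ∀ m ∈ A, m ≤ b) :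
    sSup A ∈ A ∧ ∀ m ∈ A, m ≤ sSup A :=
  ⟨Nat.sSup_mem h0 ⟨b, hb⟩, fun _ hm => le_csSup ⟨b, hb⟩ hm⟩

lemma min_spec (A : Set ℕ) (h0 : ∃ m, m ∈ A) :
    sInf A ∈ A ∧ ∀ m ∈ A, sInf A ≤ m :=
  ⟨Nat.sInf_mem h0, fun _ hm => Nat.sInf_le hm⟩

lemma ctxOf_spec (G : RegGraph V ρ) (v : V) (s : V → ℕ) (u : V) (hs : s u ≤ ρ u) :
    ctxOf G v s u ∈ ActInterval G u v ∧ (ctxOf G v s u).1 ≤ s u ∧ s u < (ctxOf G v s u).2 := by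
  obtain ⟨⟨h1, h2⟩, h3⟩ := max_spec {m | m ∈ Theta G u v ∧ m ≤ s u} (s u)
    ⟨0, zero_theta G u v, Nat.zero_le _⟩ (fun m hm => hm.2)
  obtain ⟨⟨h4, h5⟩, h6⟩ := min_spec {m | m ∈ Theta G u v ∧ s u < m}
    ⟨ρ u + 1, top_theta G u v, by omega⟩
  refine ⟨⟨h1, h4, lt_of_le_of_lt h2 h5, ?_⟩, h2, h5⟩
  rintro l hl ⟨hl1, hl2⟩
  rcases le_or_gt l (s u) with h | h
  · exact absurd (h3 l ⟨hl, h⟩) (not_le.mpr hl1)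
  · exact absurd (h6 l ⟨hl, h⟩) (not_le.mpr hl2)

lemma act_unique (G : RegGraph V ρ) {u v : V} {p q : ℕ × ℕ} (hp : p ∈ ActInterval G u v)
    (hq : q ∈ ActInterval G u v) {x : ℕ} (h1 : p.1 ≤ x) (h2 : x < p.2) (h3 : q.1 ≤ x)
    (h4 : x < q.2) : p = q := by
  obtain ⟨a1, a2, a3, a4⟩ := hp
  obtain ⟨b1, b2, b3, b4⟩ := hq
  have := a4 _ b1
  have := a4 _ b2
  have := b4 _ a1
  have := b4 _ a2
  ext <;> omega

lemma ctxOf_eq (G : RegGraph V ρ) {v : V} {s : V → ℕ} {u : V} {p : ℕ × ℕ}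
    (hp : p ∈ ActInterval G u v) (h1 : p.1 ≤ s u) (h2 : s u < p.2) : ctxOf G v s u = p := by
  have : s u ≤ ρ u := by
    have := theta_le G hp.2.1
    omega
  obtain ⟨a, b, c⟩ := ctxOf_spec G v s u this
  exact act_unique G a hp b c h1 h2

lemma ctxOf_mem (G : RegGraph V ρ) (v : V) {s : V → ℕ} (hs : s ∈ States ρ) :
    ctxOf G v s ∈ Context G v := fun u => (ctxOf_spec G v s u (hs u)).1

lemma corner_state (G : RegGraph V ρ) {v : V} {ω : V → ℕ × ℕ} (h : ω ∈ Context G v) :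
    (fun u => (ω u).1) ∈ States ρ := by
  intro u
  have := theta_le G (h u).2.1
  have := (h u).2.2.1
  show (ω u).1 ≤ ρ u
  omega

lemma ctxOf_corner (G : RegGraph V ρ) {v : V} {ω : V → ℕ × ℕ} (h : ω ∈ Context G v) :
    ctxOf G v (fun u => (ω u).1) = ω := by
  funext u
  exact ctxOf_eq G (h u) le_rfl (h u).2.2.1

lemma ctxOf_update (G : RegGraph V ρ) (v u : V) (s : V → ℕ) (j : ℕ) {p : ℕ × ℕ}
    (hp : p ∈ ActInterval G u v) (h1 : p.1 ≤ j) (h2 : j < p.2) :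
    ctxOf G v (Function.update s u j) = Function.update (ctxOf G v s) u p := by
  funext w
  by_cases hw : w = u
  · subst hw
    rw [ctxOf_eq G hp (by simpa using h1) (by simpa using h2)]
    simp
  · simp [ctxOf, hw]

lemma ctxOf_congr (G : RegGraph V ρ) (v w : V) (s t : V → ℕ) (h : s w = t w) :
    ctxOf G v s w = ctxOf G v t w := by
  simp [ctxOf, h]

/-- one-dimensional monotone target -/
noncomputable def MM (g : ℕ → ℕ) (x : ℕ) : ℕ :=
  if g x = x then x
  else if x < g x then sInf {j | x < j ∧ g j ≤ j}
  else sSup {j | j < x ∧ j ≤ g j}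

lemma delta_eq_one (G : RegGraph V ρ) (K : Param V) (v : V) (s : V → ℕ) :
    delta G K v s = 1 ↔ s v < K v (ctxOf G v s) := by
  unfold delta F
  split_ifs <;> omega

lemma delta_eq_zero (G : RegGraph V ρ) (K : Param V) (v : V) (s : V → ℕ) :
    delta G K v s = 0 ↔ K v (ctxOf G v s) = s v := by
  unfold delta F
  split_ifs <;> omega

lemma delta_eq_neg (G : RegGraph V ρ) (K : Param V) (v : V) (s : V → ℕ) :
    delta G K v s = -1 ↔ K v (ctxOf G v s) < s v := by
  unfold delta F
  split_ifs <;> omega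

/-- section of `K` along coordinate `v` -/
noncomputable def gg (G : RegGraph V ρ) (K : Param V) (v : V) (s : V → ℕ) (j : ℕ) : ℕ :=
  K v (ctxOf G v (Function.update s v j))

lemma gg_self (G : RegGraph V ρ) (K : Param V) (v : V) (s : V → ℕ) :
    gg G K v s (s v) = K v (ctxOf G v s) := by
  simp [gg]

lemma mon_eq (G : RegGraph V ρ) (K : Param V) (v : V) (s : V → ℕ) :
    mon G K v s = MM (gg G K v s) (s v) := by
  unfold mon MM
  simp only [ne_eq, delta_eq_one, delta_eq_zero, delta_eq_neg, gg_self]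
  simp only [Function.update_self, not_lt]
  rfl

lemma MM_const (g : ℕ → ℕ) (a b : ℕ) (hab : a ≤ b) (h : ∀ j, a ≤ j → j ≤ b → g j = g a) :
    MM g a = MM g b := by
  have hb := h b hab le_rfl
  unfold MM
  rw [hb]
  rcases lt_trichotomy (g a) a with h1 | h1 | h1
  · rw [if_neg (by omega), if_neg (by omega), if_neg (by omega), if_neg (by omega)]
    congr 1
    ext j
    simp only [Set.mem_setOf_eq]
    constructor
    · rintro ⟨h2, h3⟩
      exact ⟨by omega, h3⟩
    · rintro ⟨h2, h3⟩
      refine ⟨?_, h3⟩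
      by_contra h4
      have := h j (by omega) (by omega)
      omega
  · rw [if_pos h1]
    by_cases h2 : g a = b
    · rw [if_pos h2]; omega
    rw [if_neg h2, if_neg (by omega)]
    obtain ⟨⟨h3, h4⟩, h5⟩ := max_spec {j | j < b ∧ j ≤ g j} b ⟨a, by omega, by omega⟩
      (fun m hm => le_of_lt hm.1)
    have h6 := h5 a ⟨by omega, by omega⟩
    have := h _ h6 h3.le
    omega
  · rw [if_neg (by omega), if_pos h1]
    have hc : g a ≤ b → sInf {j | a < j ∧ g j ≤ j} = g a := by
      intro hgb
      have h7 := h (g a) h1.le hgb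
      obtain ⟨⟨h3, h4⟩, h5⟩ := min_spec {j | a < j ∧ g j ≤ j} ⟨g a, h1, h7.le⟩
      have h6 := h5 (g a) ⟨h1, h7.le⟩
      have := h _ h3.le (by omega)
      omega
    rcases lt_trichotomy (g a) b with h2 | h2 | h2
    · rw [if_neg (by omega), if_neg (by omega), hc h2.le]
      have h7 := h (g a) h1.le h2.le
      obtain ⟨⟨h3, h4⟩, h5⟩ := max_spec {j | j < b ∧ j ≤ g j} b ⟨g a, h2, h7.ge⟩
        (fun m hm => le_of_lt hm.1)
      have h6 := h5 (g a) ⟨h2, h7.ge⟩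
      have := h _ (by omega) h3.le
      omega
    · rw [if_pos h2, hc h2.le, h2]
    · rw [if_neg (by omega), if_pos h2]
      congr 1
      ext j
      simp only [Set.mem_setOf_eq]
      constructor
      · rintro ⟨h3, h4⟩
        refine ⟨?_, h4⟩
        by_contra h5
        have := h j (by omega) (by omega)
        omega
      · rintro ⟨h3, h4⟩
        exact ⟨by omega, h4⟩

lemma MM_sign (g : ℕ → ℕ) (x R : ℕ) (hx : x ≤ R) (hR : g R ≤ R) :
    (x < MM g x ↔ x < g x) ∧ (x = MM g x ↔ x = g x) := by
  unfold MM
  rcases lt_trichotomy (g x) x with h | h | h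
  · rw [if_neg (by omega), if_neg (by omega)]
    obtain ⟨⟨h3, h4⟩, h5⟩ := max_spec {j | j < x ∧ j ≤ g j} x ⟨0, by omega, by omega⟩
      (fun m hm => le_of_lt hm.1)
    omega
  · rw [if_pos h]; omega
  · rw [if_neg (by omega), if_pos h]
    have hne : x ≠ R := by rintro rfl; omega
    obtain ⟨⟨h3, h4⟩, h5⟩ := min_spec {j | x < j ∧ g j ≤ j} ⟨R, by omega, hR⟩
    omega

lemma MM_congr (g g' : ℕ → ℕ) (x R : ℕ) (hx : x ≤ R) (hR : g R ≤ R)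
    (h1 : ∀ j ≤ R, (j < g j ↔ j < g' j)) (h2 : ∀ j ≤ R, (j = g j ↔ j = g' j)) :
    MM g x = MM g' x := by
  have a1 := h1 x hx
  have a2 := h2 x hx
  have b1 := h1 R le_rfl
  unfold MM
  rcases lt_trichotomy (g x) x with h | h | h
  · rw [if_neg (by omega), if_neg (by omega), if_neg (by omega), if_neg (by omega)]
    congr 1
    ext j
    simp only [Set.mem_setOf_eq]
    refine and_congr_right fun hj => ?_
    have := h1 j (by omega)
    have := h2 j (by omega)
    omega
  · rw [if_pos h, if_pos (by omega)]
  · rw [if_neg (by omega), if_pos h, if_neg (by omega), if_pos (by omega)]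
    have hne : x ≠ R := by rintro rfl; omega
    obtain ⟨⟨h3, h4⟩, h5⟩ := min_spec {j | x < j ∧ g j ≤ j} ⟨R, by omega, hR⟩
    obtain ⟨⟨c3, c4⟩, c5⟩ := min_spec {j | x < j ∧ g' j ≤ j} ⟨R, by omega, by omega⟩
    have hl := h5 R ⟨by omega, hR⟩
    have hl' := c5 R ⟨by omega, by omega⟩
    have e1 := h1 _ hl
    have e2 := h1 _ hl'
    have f1 := c5 _ ⟨h3, by omega⟩
    have f2 := h5 _ ⟨c3, by omega⟩
    omega

lemma gg_top (G : RegGraph V ρ) (K : Param V) (hK : IsParam G K) (v : V) {s : V → ℕ}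
    (hs : s ∈ States ρ) : gg G K v s (ρ v) ≤ ρ v := by
  apply hK
  apply ctxOf_mem
  intro u
  by_cases hu : u = v
  · subst hu; simp
  · simpa [hu] using hs u

lemma mon_ctx (G : RegGraph V ρ) (K : Param V) (v : V) {s : V → ℕ} (hs : s ∈ States ρ) :
    NormPm G K v (ctxOf G v s) = mon G K v s := by
  unfold NormPm
  set ω := ctxOf G v s with hω
  have hmem : ω ∈ Context G v := ctxOf_mem G v hs
  have hct : ctxOf G v (fun u => (ω u).1) = ω := ctxOf_corner G hmem
  rw [mon_eq, mon_eq]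
  have hg : gg G K v (fun u => (ω u).1) = gg G K v s := by
    funext j
    unfold gg
    congr 1
    funext w
    by_cases hw : w = v
    · subst hw; apply ctxOf_congr; simp
    · have e1 : ctxOf G v (Function.update (fun u => (ω u).1) v j) w
          = ctxOf G v (fun u => (ω u).1) w := by
        apply ctxOf_congr; simp [hw]
      have e2 : ctxOf G v (Function.update s v j) w = ctxOf G v s w := by
        apply ctxOf_congr; simp [hw]
      rw [e1, e2, hct]
  rw [hg]
  obtain ⟨h1, h2, h3⟩ := ctxOf_spec G v s v (hs v)
  apply MM_const _ _ _ h2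
  intro j hj1 hj2
  unfold gg
  rw [ctxOf_update G v v s j h1 hj1 (by omega), ctxOf_update G v v s (ω v).1 h1 le_rfl (by
    exact h1.2.2.1)]

lemma F_eq_mon (G : RegGraph V ρ) (K : Param V) (hK : IsParam G K) (v : V) {s : V → ℕ}
    (hs : s ∈ States ρ) : F G K v s = if s v < mon G K v s then s v + 1
      else if s v = mon G K v s then s v else s v - 1 := by
  have := MM_sign (gg G K v s) (s v) (ρ v) (hs v) (gg_top G K hK v hs)
  rw [← mon_eq, gg_self] at this
  unfold F
  simp only [this.1, this.2]

lemma update_state {s : V → ℕ} (hs : s ∈ States ρ) (v : V) {j : ℕ} (hj : j ≤ ρ v) :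
    Function.update s v j ∈ States ρ := by
  intro u
  by_cases hu : u = v
  · subst hu; simpa using hj
  · simpa [hu] using hs u

lemma mon_congr (G G' : RegGraph V ρ) (K K' : Param V) (hK : IsParam G K)
    (hF : ∀ v, ∀ s ∈ States ρ, F G K v s = F G' K' v s) (v : V) {s : V → ℕ}
    (hs : s ∈ States ρ) : mon G K v s = mon G' K' v s := by
  rw [mon_eq, mon_eq]
  have hd : ∀ j ≤ ρ v, delta G K v (Function.update s v j) =
      delta G' K' v (Function.update s v j) := by
    intro j hj
    unfold delta
    rw [hF v _ (update_state hs v hj)]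
  apply MM_congr _ _ _ (ρ v) (hs v) (gg_top G K hK v hs)
  · intro j hj
    have e1 := delta_eq_one G K v (Function.update s v j)
    have e2 := delta_eq_one G' K' v (Function.update s v j)
    rw [hd j hj, e2] at e1
    simpa [gg] using e1.symm
  · intro j hj
    have e1 := delta_eq_zero G K v (Function.update s v j)
    have e2 := delta_eq_zero G' K' v (Function.update s v j)
    rw [hd j hj, e2] at e1
    rw [eq_comm, @eq_comm _ j]
    simpa [gg] using e1.symm

lemma F_le (G : RegGraph V ρ) (K : Param V) (hK : IsParam G K) (v : V) {s : V → ℕ}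
    (hs : s ∈ States ρ) : F G K v s ≤ ρ v := by
  have := hK v _ (ctxOf_mem G v hs)
  have := hs v
  unfold F
  split_ifs <;> omega

lemma F_of_TS_aux (G G' : RegGraph V ρ) (K K' : Param V) (hK : IsParam G K)
    (h : TS G K ⊆ TS G' K') (v : V) {s : V → ℕ} (hs : s ∈ States ρ)
    (hne : F G K v s ≠ s v) : F G K v s = F G' K' v s := by
  have hne' : s ≠ Function.update s v (F G K v s) := by
    intro hc
    apply hne
    have := congrFun hc v
    simpa using this.symm
  have hm : (s, Function.update s v (F G K v s)) ∈ TS G K :=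
    ⟨hs, update_state hs v (F_le G K hK v hs), hne', v, rfl⟩
  obtain ⟨-, -, -, w, hw⟩ := h hm
  have hv := congrFun hw v
  by_cases hvw : v = w
  · subst hvw; simpa using hv
  · simp [hvw] at hv
    exact absurd hv hne

lemma F_of_TS (G G' : RegGraph V ρ) (K K' : Param V) (hK : IsParam G K) (hK' : IsParam G' K')
    (h : TS G K = TS G' K') (v : V) {s : V → ℕ} (hs : s ∈ States ρ) :
    F G K v s = F G' K' v s := by
  by_cases h1 : F G K v s = s v
  · by_cases h2 : F G' K' v s = s v
    · rw [h1, h2]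
    · exact (F_of_TS_aux G' G K' K hK' h.ge v hs h2).symm
  · exact F_of_TS_aux G G' K K' hK h.le v hs h1

lemma TS_of_F (G G' : RegGraph V ρ) (K K' : Param V)
    (hF : ∀ v, ∀ s ∈ States ρ, F G K v s = F G' K' v s) : TS G K = TS G' K' := by
  ext p
  unfold TS
  simp only [Set.mem_setOf_eq]
  refine and_congr_right fun hs => and_congr_right fun _ => and_congr_right fun _ => ?_
  exact exists_congr fun v => by rw [hF v _ hs]

lemma nplus_spec (G : RegGraph V ρ) {u v : V} {n : ℕ} (h : (u, n, v) ∈ G.E) :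
    (n, nplus G u v n) ∈ ActInterval G u v := by
  have hv := (G.valid _ h).2
  simp only at hv
  obtain ⟨⟨h1, h2⟩, h3⟩ := min_spec {m | m ∈ Theta G u v ∧ n < m}
    ⟨ρ u + 1, top_theta G u v, by omega⟩
  refine ⟨Or.inl h, h1, h2, ?_⟩
  rintro l hl ⟨l1, l2⟩
  exact absurd (h3 l ⟨hl, l1⟩) (not_le.mpr l2)

lemma nminus_spec (G : RegGraph V ρ) {u v : V} {n : ℕ} (h : (u, n, v) ∈ G.E) :
    (nminus G u v n, n) ∈ ActInterval G u v := by
  have hv := (G.valid _ h).1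
  simp only at hv
  obtain ⟨⟨h1, h2⟩, h3⟩ := max_spec {m | m ∈ Theta G u v ∧ m < n} n
    ⟨0, zero_theta G u v, by omega⟩ (fun m hm => le_of_lt hm.2)
  refine ⟨h1, Or.inl h, h2, ?_⟩
  rintro l hl ⟨l1, l2⟩
  exact absurd (h3 l ⟨hl, l2⟩) (not_le.mpr l1)

lemma ctxOf_theta (G G' : RegGraph V ρ) (u v : V) (s : V → ℕ)
    (h : Theta G u v = Theta G' u v) : ctxOf G v s u = ctxOf G' v s u := by
  simp [ctxOf, h]

lemma min_step (G G1 : RegGraph V ρ) (N : Param V) (e : V × ℕ × V) (he : e ∈ G.E)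
    (hE : ∀ x, x ∈ G1.E ↔ x ≠ e ∧ x ∈ G.E) (hn : NotObsParam G N e) (w : V) {s : V → ℕ}
    (hs : s ∈ States ρ) :
    MinParam G N e w (ctxOf G1 w s) = N w (ctxOf G w s) := by
  obtain ⟨u, n, v⟩ := e
  have hval := G.valid _ he
  simp only at hval
  have hmin := nminus_spec G he
  have hplus := nplus_spec G he
  have hth : ∀ u' w', ¬ (u' = u ∧ w' = v) → Theta G1 u' w' = Theta G u' w' := by
    intro u' w' hne
    ext m
    simp only [Theta, Set.mem_union, Set.mem_setOf_eq, hE]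
    have : (u', m, w') ≠ (u, n, v) := by
      intro hc
      simp only [Prod.mk.injEq] at hc
      exact hne ⟨hc.1, hc.2.2⟩
    simp [this]
  have hth2 : ∀ m, m ∈ Theta G1 u v ↔ m ≠ n ∧ m ∈ Theta G u v := by
    intro m
    simp only [Theta, Set.mem_union, Set.mem_setOf_eq, hE, Set.mem_insert_iff,
      Set.mem_singleton_iff, ne_eq, Prod.mk.injEq, true_and, and_true]
    constructor
    · rintro (h | h)
      · exact ⟨h.1, Or.inl h.2⟩
      · exact ⟨by omega, Or.inr h⟩
    · rintro ⟨h, h' | h'⟩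
      · exact Or.inl ⟨h, h'⟩
      · exact Or.inr h'
  unfold MinParam
  simp only
  by_cases hw : w = v
  swap
  · rw [if_neg (fun h => hw h.1)]
    congr 1
    funext u'
    exact ctxOf_theta _ _ _ _ _ (hth _ _ (fun h => hw h.2))
  subst hw
  have hoff : ∀ u', u' ≠ u → ctxOf G1 w s u' = ctxOf G w s u' := fun u' hu' =>
    ctxOf_theta _ _ _ _ _ (hth _ _ (fun h => hu' h.1))
  have hupd : ∀ p, Function.update (ctxOf G1 w s) u p = Function.update (ctxOf G w s) u p := by
    intro p
    funext u'
    by_cases hu : u' = u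
    · subst hu; simp
    · simp [hu, hoff u' hu]
  set nm := nminus G u w n
  set np := nplus G u w n
  obtain ⟨m1, -, m3, m4⟩ := id hmin
  obtain ⟨-, p2, p3, p4⟩ := id hplus
  simp only at m1 m3 m4 p2 p3 p4
  by_cases hin : nm ≤ s u ∧ s u < np
  · have hact : (nm, np) ∈ ActInterval G1 u w := by
      refine ⟨(hth2 _).2 ⟨by simp only; omega, m1⟩, (hth2 _).2 ⟨by simp only; omega, p2⟩,
        by simp only; omega, ?_⟩
      intro l hl hc
      obtain ⟨l1, l2⟩ := (hth2 _).1 hl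
      have := m4 l l2
      have := p4 l l2
      simp only at hc
      omega
    rw [if_pos ⟨rfl, ctxOf_eq G1 hact hin.1 hin.2⟩, hupd]
    by_cases hsn : s u < n
    · rw [← ctxOf_eq G hmin hin.1 hsn, Function.update_eq_self]
    · exact (hn _ (ctxOf_mem G w hs) (ctxOf_eq G hplus (by simp only; omega) hin.2)).symm
  · obtain ⟨⟨q1, q2, q3, q4⟩, a2, a3⟩ := ctxOf_spec G w s u (hs u)
    have hact : ctxOf G w s u ∈ ActInterval G1 u w := by
      have := q4 _ m1
      have := q4 _ p2
      refine ⟨(hth2 _).2 ⟨by omega, q1⟩, (hth2 _).2 ⟨by omega, q2⟩, q3, ?_⟩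
      intro l hl
      exact q4 l ((hth2 _).1 hl).2
    have heq : ctxOf G1 w s u = ctxOf G w s u := ctxOf_eq G1 hact a2 a3
    rw [if_neg]
    · congr 1
      funext u'
      by_cases hu : u' = u
      · subst hu; exact heq
      · exact hoff u' hu
    · rintro ⟨-, hc⟩
      rw [heq] at hc
      rw [hc] at a2 a3
      exact hin ⟨a2, a3⟩

lemma minim_inv [LinearOrder (V × ℕ × V)] (P : RegGraph V ρ × Param V) (w : V) {s : V → ℕ}
    (hs : s ∈ States ρ) :
    (Minim P).2 w (ctxOf (Minim P).1 w s) = P.2 w (ctxOf P.1 w s) := by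
  unfold Minim
  split_ifs with h
  · have hm := Finset.min'_mem _ h
    obtain ⟨h1, h2⟩ := Finset.mem_filter.mp hm
    exact min_step P.1 _ P.2 _ h1 (fun x => Finset.mem_erase) h2 w hs
  · rfl

lemma iter_inv [LinearOrder (V × ℕ × V)] (n : ℕ) (P : RegGraph V ρ × Param V) (w : V)
    {s : V → ℕ} (hs : s ∈ States ρ) :
    (Minim^[n] P).2 w (ctxOf (Minim^[n] P).1 w s) = P.2 w (ctxOf P.1 w s) := by
  induction n with
  | zero => rfl
  | succ k ih => rw [Function.iterate_succ_apply', minim_inv _ w hs, ih]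

lemma fix_obs [LinearOrder (V × ℕ × V)] (P : RegGraph V ρ × Param V) (h : Minim P = P)
    (e : V × ℕ × V) (he : e ∈ P.1.E) : ¬ NotObsParam P.1 P.2 e := by
  intro hn
  have hne : (nonObsEdges P.1 P.2).Nonempty := ⟨e, Finset.mem_filter.mpr ⟨he, hn⟩⟩
  unfold Minim at h
  rw [dif_pos hne] at h
  have hm := Finset.min'_mem _ hne
  obtain ⟨h1, -⟩ := Finset.mem_filter.mp hm
  have h2 := congrArg (fun Q : RegGraph V ρ × Param V => Q.1.E) h
  simp only at h2
  rw [← h2] at h1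
  exact (Finset.mem_erase.mp h1).1 rfl

lemma edge_sub (P P' : RegGraph V ρ × Param V) 
    (hobs : ∀ e ∈ P.1.E, ¬ NotObsParam P.1 P.2 e)
    (hf : ∀ v, ∀ s ∈ States ρ, P.2 v (ctxOf P.1 v s) = P'.2 v (ctxOf P'.1 v s)) :
    P.1.E ⊆ P'.1.E := by
  intro e he
  by_contra hne
  apply hobs e he
  obtain ⟨u, n, v⟩ := e
  have hval := P.1.valid _ he
  simp only at hval
  intro ω hω hωu
  simp only at hω hωu ⊢
  have hs := corner_state P.1 hω
  set s : V → ℕ := fun u => (ω u).1 with hsdef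
  have hsu : s u = n := by simp [hsdef, hωu]
  have hc : ctxOf P.1 v s = ω := ctxOf_corner P.1 hω
  have hmin := nminus_spec P.1 he
  have hlt : nminus P.1 u v n < n := hmin.2.2.1
  have hc' : ctxOf P.1 v (Function.update s u (n - 1)) =
      Function.update ω u (nminus P.1 u v n, n) := by
    rw [ctxOf_update P.1 v u s (n - 1) hmin (by simp only; omega) (by simp only; omega), hc]
  have hs' : Function.update s u (n - 1) ∈ States ρ := update_state hs u (by omega)
  rw [← hc', hf v _ hs', ← hc, hf v _ hs]
  obtain ⟨q, a2, a3⟩ := ctxOf_spec P'.1 v s u (hs u)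
  have hn0 : (ctxOf P'.1 v s u).1 ≠ n := by
    intro h
    rcases q.1 with h' | h'
    · rw [h] at h'; exact hne h'
    · rw [h] at h'; simp at h'; omega
  rw [ctxOf_update P'.1 v u s (n - 1) q (by omega) (by omega), Function.update_eq_self]

lemma RegGraph_ext (G G' : RegGraph V ρ) (h : G.E = G'.E) : G = G' := by
  cases G; cases G'; cases h; rfl

/-- Two parametrized regulatory graphs (sharing `V` and `ρ`)
generate the same asynchronous transition system iff the fixed points of the
iterated minimizations of their normalizations coincide. -/
theorem equivalence_via_minimization {V : Type*} [DecidableEq V] [Fintype V]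
    [LinearOrder (V × ℕ × V)] {ρ : V → ℕ} (hρ : ∀ v, 1 ≤ ρ v)
    (G G' : RegGraph V ρ) (K K' : Param V)
    (hK : IsParam G K) (hK' : IsParam G' K')
    (P P' : RegGraph V ρ × Param V)
    (hP : IsFixReached Minim (G, NormPm G K) P)
    (hP' : IsFixReached Minim (G', NormPm G' K') P') :
    TS G K = TS G' K' ↔ PGEq P P' := by
  obtain ⟨⟨n, rfl⟩, hfix⟩ := hP
  obtain ⟨⟨n', rfl⟩, hfix'⟩ := hP'
  have hf : ∀ v, ∀ s ∈ States ρ, (Minim^[n] (G, NormPm G K)).2 v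
      (ctxOf (Minim^[n] (G, NormPm G K)).1 v s) = mon G K v s := fun v s hs => by
    rw [iter_inv n _ v hs]; exact mon_ctx G K v hs
  have hf' : ∀ v, ∀ s ∈ States ρ, (Minim^[n'] (G', NormPm G' K')).2 v
      (ctxOf (Minim^[n'] (G', NormPm G' K')).1 v s) = mon G' K' v s := fun v s hs => by
    rw [iter_inv n' _ v hs]; exact mon_ctx G' K' v hs
  generalize (Minim^[n] (G, NormPm G K)) = P at *
  generalize (Minim^[n'] (G', NormPm G' K')) = P' at *
  constructor
  · intro hTS
    have hmon : ∀ v, ∀ s ∈ States ρ, mon G K v s = mon G' K' v s := fun v s hs =>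
      mon_congr G G' K K' hK (fun v s hs => F_of_TS G G' K K' hK hK' hTS v hs) v hs
    have hff : ∀ v, ∀ s ∈ States ρ, P.2 v (ctxOf P.1 v s) = P'.2 v (ctxOf P'.1 v s) :=
      fun v s hs => by rw [hf v s hs, hf' v s hs, hmon v s hs]
    have hG : P.1 = P'.1 := RegGraph_ext _ _ (Finset.Subset.antisymm
      (edge_sub P P' (fix_obs P hfix) hff)
      (edge_sub P' P (fix_obs P' hfix') (fun v s hs => (hff v s hs).symm)))
    refine ⟨hG, fun v ω hω => ?_⟩
    have h1 := hff v _ (corner_state P.1 hω)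
    rw [← hG, ctxOf_corner P.1 hω] at h1
    exact h1
  · rintro ⟨hG, hN⟩
    apply TS_of_F
    intro v s hs
    have hm : mon G K v s = mon G' K' v s := by
      rw [← hf v s hs, ← hf' v s hs, ← hG]
      exact hN v _ (ctxOf_mem P.1 v hs)
    rw [F_eq_mon G K hK v hs, F_eq_mon G' K' hK' v hs, hm]

end MVReg
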